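/- Let τ belong to class 𝒯. Then there exist n ∈ ℕ and C > 0 such that for all f ∈ BV_I, ‖P_τ^n f‖_BV ≤ (1/2)·‖f‖_BV + C·‖f‖_1, where ‖f‖_BV = ‖f‖_1 + var_I f. -/

import Mathlib

open Set Filter MeasureTheory Topology

structure PCT where
  τ : ℝ → ℝ
  a : ℕ → ℝ
  b : ℕ → ℝ
  da : ℕ → ℝ
  maps_to : Set.MapsTo τ (Set.Icc 0 1) (Set.Icc 0 1)
  lt : ∀ i, a i < b i
  sub : ∀ i, Set.Ioo (a i) (b i) ⊆ Set.Icc (0:ℝ) 1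
  disj : Pairwise (Function.onFun Disjoint fun i => Set.Ioo (a i) (b i))
  null : volume (Set.Icc (0:ℝ) 1 \ ⋃ i, Set.Ioo (a i) (b i)) = 0
  mono : ∀ i, StrictMonoOn τ (Set.Ioo (a i) (b i))
  conv : ∀ i, ConvexOn ℝ (Set.Ioo (a i) (b i)) τ
  diff : ∀ i, ∀ x ∈ Set.Ioo (a i) (b i), DifferentiableAt ℝ τ x
  lim_zero : ∀ i, Filter.Tendsto τ (nhdsWithin (a i) (Set.Ioi (a i))) (nhds 0)
  deriv_lim : ∀ i, Filter.Tendsto (deriv τ) (nhdsWithin (a i) (Set.Ioi (a i))) (nhds (da i))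
  da_pos : ∀ i, 0 < da i
  sum_inv : Summable (fun i => 1 / da i)
  expand : (¬ AccPt (0:ℝ) (Filter.principal (Set.range a))) → ∃ i, a i = 0 ∧ 1 < da i

/-- The interval `(c,d)` follows a single sequence of branches under the first `n`
iterates of `τ`. -/
def IsBranchSeq (T : PCT) (n : ℕ) (c d : ℝ) : Prop :=
  c < d ∧ ∀ k < n, ∃ i, T.τ^[k] '' Set.Ioo c d ⊆ Set.Ioo (T.a i) (T.b i)

/-- `(c,d)` is a maximal open interval on which `τ^n` is a single monotone branch,
i.e. an element of the partition `𝒫⁽ⁿ⁾`. -/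
def IsBranchInterval (T : PCT) (n : ℕ) (c d : ℝ) : Prop :=
  IsBranchSeq T n c d ∧
    ∀ c' d', c' ≤ c → d ≤ d' → IsBranchSeq T n c' d' → c' = c ∧ d' = d

/-- The pair `(ψ, h)` consists of a nondecreasing concave self-map `ψ` of `[0,1]` together with
a nonnegative supergradient `h` of `ψ` which vanishes wherever `ψ` becomes constant. -/
structure IsConcaveBranch (ψ h : ℝ → ℝ) : Prop where
  mapsTo : MapsTo ψ (Icc 0 1) (Icc 0 1)
  nonneg : ∀ x ∈ Icc (0:ℝ) 1, 0 ≤ h x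
  lower : ∀ x ∈ Icc (0:ℝ) 1, ∀ y ∈ Icc (0:ℝ) 1, x ≤ y → h y * (y - x) ≤ ψ y - ψ x
  upper : ∀ x ∈ Icc (0:ℝ) 1, ∀ y ∈ Icc (0:ℝ) 1, x ≤ y → ψ y - ψ x ≤ h x * (y - x)
  flat : ∀ x ∈ Icc (0:ℝ) 1, ∀ y ∈ Icc (0:ℝ) 1, x < y → ψ x = ψ y → h x = 0

namespace IsConcaveBranch

variable {ψ h ψ' h' : ℝ → ℝ}

theorem monotoneOn (H : IsConcaveBranch ψ h) : MonotoneOn ψ (Icc 0 1) := by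
  intro x hx y hy hxy
  have := H.lower x hx y hy hxy
  have := mul_nonneg (H.nonneg y hy) (sub_nonneg.2 hxy)
  linarith

theorem antitoneOn (H : IsConcaveBranch ψ h) : AntitoneOn h (Icc 0 1) := by
  intro x hx y hy hxy
  rcases hxy.eq_or_lt with rfl | hlt
  · rfl
  · exact le_of_mul_le_mul_right ((H.lower x hx y hy hxy).trans (H.upper x hx y hy hxy))
      (sub_pos.2 hlt)

theorem le_zero (H : IsConcaveBranch ψ h) {x : ℝ} (hx : x ∈ Icc (0:ℝ) 1) : h x ≤ h 0 :=
  H.antitoneOn (left_mem_Icc.2 zero_le_one) hx hx.1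

protected theorem id : IsConcaveBranch (fun x => x) (fun _ => 1) where
  mapsTo := fun _ hx => hx
  nonneg := fun _ _ => zero_le_one
  lower := fun _ _ _ _ _ => by simp
  upper := fun _ _ _ _ _ => by simp
  flat := fun _ _ _ _ hlt he => absurd he hlt.ne

theorem comp (H : IsConcaveBranch ψ h) (H' : IsConcaveBranch ψ' h') :
    IsConcaveBranch (fun x => ψ (ψ' x)) (fun x => h (ψ' x) * h' x) where
  mapsTo := fun _ hx => H.mapsTo (H'.mapsTo hx)
  nonneg := fun x hx => mul_nonneg (H.nonneg _ (H'.mapsTo hx)) (H'.nonneg x hx)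
  lower := fun x hx y hy hxy => by
    have h1 := H.lower _ (H'.mapsTo hx) _ (H'.mapsTo hy) (H'.monotoneOn hx hy hxy)
    have h2 := mul_le_mul_of_nonneg_left (H'.lower x hx y hy hxy) (H.nonneg _ (H'.mapsTo hy))
    rw [mul_assoc]
    exact h2.trans h1
  upper := fun x hx y hy hxy => by
    have h1 := H.upper _ (H'.mapsTo hx) _ (H'.mapsTo hy) (H'.monotoneOn hx hy hxy)
    have h2 := mul_le_mul_of_nonneg_left (H'.upper x hx y hy hxy) (H.nonneg _ (H'.mapsTo hx))
    rw [mul_assoc]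
    exact h1.trans h2
  flat := fun x hx y hy hlt he => by
    rcases (H'.monotoneOn hx hy hlt.le).eq_or_lt with h1 | h1
    · rw [H'.flat x hx y hy hlt h1, mul_zero]
    · rw [H.flat _ (H'.mapsTo hx) _ (H'.mapsTo hy) h1 he, zero_mul]

end IsConcaveBranch

namespace PCT

/-- The `i`-th branch of `τ`, extended by `0` to the left endpoint. -/
noncomputable def branch (T : PCT) (i : ℕ) (x : ℝ) : ℝ := if x = T.a i then 0 else T.τ x

/-- The derivative of the `i`-th branch, extended by right-continuity to the left endpoint. -/
noncomputable def branchDeriv (T : PCT) (i : ℕ) (x : ℝ) : ℝ :=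
  if x = T.a i then T.da i else deriv T.τ x

open Classical in
/-- The inverse of the `i`-th branch, extended by the constant `b i`. -/
noncomputable def invBranch (T : PCT) (i : ℕ) (y : ℝ) : ℝ :=
  if h : ∃ x ∈ Ico (T.a i) (T.b i), T.branch i x = y then h.choose else T.b i

open Classical in
/-- The right derivative of `invBranch`. -/
noncomputable def weight (T : PCT) (i : ℕ) (y : ℝ) : ℝ :=
  if ∃ x ∈ Ico (T.a i) (T.b i), T.branch i x = y then 1 / T.branchDeriv i (T.invBranch i y) else 0

variable (T : PCT) (i : ℕ)

theorem Icc_subset : Icc (T.a i) (T.b i) ⊆ Icc 0 1 := by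
  rw [← closure_Ioo (T.lt i).ne]
  exact closure_minimal (T.sub i) isClosed_Icc

theorem a_nonneg : 0 ≤ T.a i := (T.Icc_subset i (left_mem_Icc.2 (T.lt i).le)).1

theorem inv_da_nonneg : 0 ≤ 1 / T.da i := (one_div_pos.2 (T.da_pos i)).le

theorem inv_da_le_tsum : 1 / T.da i ≤ ∑' j, 1 / T.da j :=
  T.sum_inv.le_tsum i fun j _ => T.inv_da_nonneg j

variable {T i}

theorem branch_left : T.branch i (T.a i) = 0 := if_pos rfl

theorem branch_of_mem {x : ℝ} (hx : x ∈ Ioo (T.a i) (T.b i)) : T.branch i x = T.τ x :=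
  if_neg hx.1.ne'

theorem branchDeriv_left : T.branchDeriv i (T.a i) = T.da i := if_pos rfl

theorem branchDeriv_of_mem {x : ℝ} (hx : x ∈ Ioo (T.a i) (T.b i)) :
    T.branchDeriv i x = deriv T.τ x :=
  if_neg hx.1.ne'

theorem deriv_mul_le {x y : ℝ} (hx : x ∈ Ioo (T.a i) (T.b i)) (hy : y ∈ Ioo (T.a i) (T.b i))
    (hxy : x ≤ y) : deriv T.τ x * (y - x) ≤ T.τ y - T.τ x := by
  rcases hxy.eq_or_lt with rfl | hlt
  · simp
  · have := (T.conv i).deriv_le_slope hx hy hlt (T.diff i x hx)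
    rwa [slope_def_field, le_div_iff₀ (sub_pos.2 hlt)] at this

theorem le_deriv_mul {x y : ℝ} (hx : x ∈ Ioo (T.a i) (T.b i)) (hy : y ∈ Ioo (T.a i) (T.b i))
    (hxy : x ≤ y) : T.τ y - T.τ x ≤ deriv T.τ y * (y - x) := by
  rcases hxy.eq_or_lt with rfl | hlt
  · simp
  · have := (T.conv i).slope_le_deriv hx hy hlt (T.diff i y hy)
    rwa [slope_def_field, div_le_iff₀ (sub_pos.2 hlt)] at this

theorem eventually_mem_Ioo {y : ℝ} (hy : T.a i < y) (hyb : y < T.b i) :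
    ∀ᶠ t in 𝓝[>] T.a i, t ∈ Ioo (T.a i) (T.b i) ∧ t ≤ y := by
  filter_upwards [Ioo_mem_nhdsGT hy] with t ht
  exact ⟨⟨ht.1, ht.2.trans hyb⟩, ht.2.le⟩

theorem da_le_deriv {y : ℝ} (hy : y ∈ Ioo (T.a i) (T.b i)) : T.da i ≤ deriv T.τ y := by
  refine le_of_tendsto (T.deriv_lim i) ?_
  filter_upwards [eventually_mem_Ioo hy.1 hy.2] with t ht
  exact (T.conv i).monotoneOn_deriv (T.diff i) ht.1 hy ht.2

theorem tendsto_const_sub (y : ℝ) :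
    Tendsto (fun t => y - t) (𝓝[>] T.a i) (𝓝 (y - T.a i)) :=
  (tendsto_id.mono_left nhdsWithin_le_nhds).const_sub y

theorem branchDeriv_pos {x : ℝ} (hx : x ∈ Ico (T.a i) (T.b i)) : 0 < T.branchDeriv i x := by
  rcases hx.1.eq_or_lt with rfl | h
  · rw [branchDeriv_left]; exact T.da_pos i
  · rw [branchDeriv_of_mem ⟨h, hx.2⟩]; exact (T.da_pos i).trans_le (da_le_deriv ⟨h, hx.2⟩)

theorem branchDeriv_mul_le {x y : ℝ} (hx : x ∈ Ico (T.a i) (T.b i))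
    (hy : y ∈ Ico (T.a i) (T.b i)) (hxy : x ≤ y) :
    T.branchDeriv i x * (y - x) ≤ T.branch i y - T.branch i x := by
  rcases hxy.eq_or_lt with rfl | hlt
  · simp
  have hy' : y ∈ Ioo (T.a i) (T.b i) := ⟨hx.1.trans_lt hlt, hy.2⟩
  rw [branch_of_mem hy']
  rcases hx.1.eq_or_lt with rfl | h
  · rw [branchDeriv_left, branch_left]
    refine le_of_tendsto_of_tendsto ((T.deriv_lim i).mul (tendsto_const_sub y))
      ((T.lim_zero i).const_sub _) ?_
    filter_upwards [eventually_mem_Ioo hy'.1 hy'.2] with t ht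
    exact deriv_mul_le ht.1 hy' ht.2
  · rw [branchDeriv_of_mem ⟨h, hx.2⟩, branch_of_mem ⟨h, hx.2⟩]
    exact deriv_mul_le ⟨h, hx.2⟩ hy' hxy

theorem le_branchDeriv_mul {x y : ℝ} (hx : x ∈ Ico (T.a i) (T.b i))
    (hy : y ∈ Ico (T.a i) (T.b i)) (hxy : x ≤ y) :
    T.branch i y - T.branch i x ≤ T.branchDeriv i y * (y - x) := by
  rcases hxy.eq_or_lt with rfl | hlt
  · simp
  have hy' : y ∈ Ioo (T.a i) (T.b i) := ⟨hx.1.trans_lt hlt, hy.2⟩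
  rw [branch_of_mem hy', branchDeriv_of_mem hy']
  rcases hx.1.eq_or_lt with rfl | h
  · rw [branch_left]
    refine le_of_tendsto_of_tendsto ((T.lim_zero i).const_sub _)
      ((tendsto_const_sub y).const_mul _) ?_
    filter_upwards [eventually_mem_Ioo hy'.1 hy'.2] with t ht
    exact le_deriv_mul ht.1 hy' ht.2
  · rw [branch_of_mem ⟨h, hx.2⟩]
    exact le_deriv_mul ⟨h, hx.2⟩ hy' hxy

theorem branch_strictMonoOn : StrictMonoOn (T.branch i) (Ico (T.a i) (T.b i)) := by
  intro x hx y hy hxy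
  have := branchDeriv_mul_le hx hy hxy.le
  have := mul_pos (branchDeriv_pos hx) (sub_pos.2 hxy)
  linarith

theorem branch_continuousOn : ContinuousOn (T.branch i) (Ico (T.a i) (T.b i)) := by
  intro x hx
  rcases hx.1.eq_or_lt with rfl | h
  · have h1 : ContinuousWithinAt (T.branch i) (Ioi (T.a i)) (T.a i) := by
      rw [ContinuousWithinAt, branch_left]
      refine (T.lim_zero i).congr' ?_
      filter_upwards [self_mem_nhdsWithin] with t ht
      exact (if_neg (ne_of_gt ht)).symm
    exact (continuousWithinAt_Ioi_iff_Ici.1 h1).mono Ico_subset_Ici_self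
  · refine ((T.diff i x ⟨h, hx.2⟩).continuousAt.congr ?_).continuousWithinAt
    filter_upwards [Ioo_mem_nhds h hx.2] with t ht
    exact (branch_of_mem ht).symm

theorem invBranch_branch {x : ℝ} (hx : x ∈ Ico (T.a i) (T.b i)) :
    T.invBranch i (T.branch i x) = x := by
  have h : ∃ z ∈ Ico (T.a i) (T.b i), T.branch i z = T.branch i x := ⟨x, hx, rfl⟩
  rw [invBranch, dif_pos h]
  exact branch_strictMonoOn.injOn h.choose_spec.1 hx h.choose_spec.2

theorem weight_branch {x : ℝ} (hx : x ∈ Ico (T.a i) (T.b i)) :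
    T.weight i (T.branch i x) = 1 / T.branchDeriv i x := by
  rw [weight, if_pos ⟨x, hx, rfl⟩, invBranch_branch hx]

theorem exists_branch_eq_or {y : ℝ} (hy : 0 ≤ y) :
    (∃ x ∈ Ico (T.a i) (T.b i), T.branch i x = y) ∨
      (∀ x ∈ Ico (T.a i) (T.b i), T.branch i x < y) ∧ T.invBranch i y = T.b i ∧
        T.weight i y = 0 := by
  by_cases h : ∃ x ∈ Ico (T.a i) (T.b i), T.branch i x = y
  · exact Or.inl h
  · refine Or.inr ⟨fun x hx => ?_, dif_neg h, if_neg h⟩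
    by_contra! hle
    obtain ⟨z, hz, hzy⟩ := intermediate_value_Icc hx.1
      (branch_continuousOn.mono (Icc_subset_Ico_right hx.2))
      (show y ∈ Icc (T.branch i (T.a i)) (T.branch i x) by rw [branch_left]; exact ⟨hy, hle⟩)
    exact h ⟨z, ⟨hz.1, hz.2.trans_lt hx.2⟩, hzy⟩

theorem invBranch_zero : T.invBranch i 0 = T.a i := by
  have := invBranch_branch (left_mem_Ico.2 (T.lt i))
  rwa [branch_left] at this

theorem weight_zero : T.weight i 0 = 1 / T.da i := by
  have := weight_branch (left_mem_Ico.2 (T.lt i))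
  rwa [branch_left, branchDeriv_left] at this

theorem invBranch_mem {y : ℝ} (hy : 0 ≤ y) : T.invBranch i y ∈ Icc (T.a i) (T.b i) := by
  rcases exists_branch_eq_or (T := T) (i := i) hy with ⟨x, hx, rfl⟩ | ⟨-, h, -⟩
  · rw [invBranch_branch hx]; exact Ico_subset_Icc_self hx
  · rw [h]; exact right_mem_Icc.2 (T.lt i).le

theorem isConcaveBranch (T : PCT) (i : ℕ) :
    IsConcaveBranch (T.invBranch i) (T.weight i) where
  mapsTo := fun _ hy => T.Icc_subset i (invBranch_mem hy.1)
  nonneg := fun y hy => by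
    rcases exists_branch_eq_or (T := T) (i := i) hy.1 with ⟨x, hx, rfl⟩ | ⟨-, -, h⟩
    · rw [weight_branch hx]; exact (one_div_pos.2 (branchDeriv_pos hx)).le
    · rw [h]
  lower := fun y hy z hz hyz => by
    rcases exists_branch_eq_or (T := T) (i := i) hz.1 with ⟨x', hx', rfl⟩ | ⟨-, hb, h⟩
    · rcases exists_branch_eq_or (T := T) (i := i) hy.1 with ⟨x, hx, rfl⟩ | ⟨h, -, -⟩
      · rw [weight_branch hx', invBranch_branch hx, invBranch_branch hx', one_div,
          inv_mul_le_iff₀ (branchDeriv_pos hx')]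
        exact le_branchDeriv_mul hx hx' ((branch_strictMonoOn.le_iff_le hx hx').1 hyz)
      · exact absurd hyz (h x' hx').not_ge
    · rw [h, zero_mul, hb]
      exact sub_nonneg.2 (invBranch_mem hy.1).2
  upper := fun y hy z hz hyz => by
    rcases exists_branch_eq_or (T := T) (i := i) hy.1 with ⟨x, hx, rfl⟩ | ⟨h, hb, h0⟩
    · rw [weight_branch hx, invBranch_branch hx, one_div, ← div_eq_inv_mul,
        le_div_iff₀' (branchDeriv_pos hx)]
      rcases exists_branch_eq_or (T := T) (i := i) hz.1 with ⟨x', hx', rfl⟩ | ⟨h, hb, -⟩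
      · rw [invBranch_branch hx']
        exact branchDeriv_mul_le hx hx' ((branch_strictMonoOn.le_iff_le hx hx').1 hyz)
      · rw [hb]
        refine le_of_tendsto (x := 𝓝[<] T.b i) (f := fun t => T.branchDeriv i x * (t - x))
          (((tendsto_id.mono_left nhdsWithin_le_nhds).sub_const x).const_mul _) ?_
        filter_upwards [Ioo_mem_nhdsLT hx.2] with t ht
        have ht' : t ∈ Ico (T.a i) (T.b i) := ⟨hx.1.trans ht.1.le, ht.2⟩
        exact (branchDeriv_mul_le hx ht' ht.1.le).trans (sub_le_sub_right (h t ht').le _)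
    · rw [hb, h0, zero_mul, sub_nonpos]
      exact (invBranch_mem hz.1).2
  flat := fun y hy z hz hyz he => by
    rcases exists_branch_eq_or (T := T) (i := i) hy.1 with ⟨x, hx, rfl⟩ | ⟨-, -, h0⟩
    · exfalso
      rw [invBranch_branch hx] at he
      rcases exists_branch_eq_or (T := T) (i := i) hz.1 with ⟨x', hx', rfl⟩ | ⟨-, hb, -⟩
      · rw [invBranch_branch hx'] at he
        exact hyz.ne (by rw [he])
      · exact hx.2.ne (he.trans hb)
    · exact h0

theorem weight_le {y : ℝ} (hy : y ∈ Icc (0:ℝ) 1) : T.weight i y ≤ 1 / T.da i :=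
  weight_zero (T := T) (i := i) ▸ (T.isConcaveBranch i).le_zero hy

end PCT

namespace PCT

/-- Words of length `n` in the alphabet of branches. -/
def Word : ℕ → Type
  | 0 => Unit
  | n + 1 => ℕ × Word n

/-- The inverse branch of `τ^n` attached to a word of length `n`. -/
noncomputable def wordInv (T : PCT) : (n : ℕ) → Word n → ℝ → ℝ
  | 0, _, y => y
  | n + 1, w, y => T.invBranch w.1 (T.wordInv n w.2 y)

/-- The right derivative of `wordInv`. -/
noncomputable def wordWeight (T : PCT) : (n : ℕ) → Word n → ℝ → ℝ
  | 0, _, _ => 1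
  | n + 1, w, y => T.weight w.1 (T.wordInv n w.2 y) * T.wordWeight n w.2 y

theorem isConcaveBranch_word (T : PCT) :
    ∀ (n : ℕ) (w : Word n), IsConcaveBranch (T.wordInv n w) (T.wordWeight n w)
  | 0, _ => IsConcaveBranch.id
  | n + 1, w => (T.isConcaveBranch w.1).comp (T.isConcaveBranch_word n w.2)

theorem zero_mem_Icc : (0:ℝ) ∈ Icc (0:ℝ) 1 := left_mem_Icc.2 zero_le_one

theorem one_mem_Icc : (1:ℝ) ∈ Icc (0:ℝ) 1 := right_mem_Icc.2 zero_le_one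

theorem wordWeight_zero_nonneg (T : PCT) (n : ℕ) (w : Word n) : 0 ≤ T.wordWeight n w 0 :=
  (T.isConcaveBranch_word n w).nonneg 0 zero_mem_Icc

theorem summable_wordWeight_zero (T : PCT) : ∀ n, Summable fun w : Word n => T.wordWeight n w 0
  | 0 => by
    have : Finite (Word 0) := inferInstanceAs (Finite Unit)
    exact Summable.of_finite
  | n + 1 => by
    have h := T.sum_inv.mul_of_nonneg (T.summable_wordWeight_zero n) T.inv_da_nonneg
      (T.wordWeight_zero_nonneg n)
    refine Summable.of_nonneg_of_le (T.wordWeight_zero_nonneg (n + 1)) (fun w => ?_) h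
    exact mul_le_mul_of_nonneg_right
      (weight_le ((T.isConcaveBranch_word n w.2).mapsTo zero_mem_Icc))
      (T.wordWeight_zero_nonneg n w.2)

/-- A monotone function increases by at most its total increment over finitely many of the
partition intervals. -/
theorem sum_sub_le_of_monotoneOn (T : PCT) {V : ℝ → ℝ} (hV : MonotoneOn V (Icc 0 1))
    (S : Finset ℕ) {d : ℝ} (hd : d ∈ Icc (0:ℝ) 1) (hS : ∀ i ∈ S, T.b i ≤ d) :
    ∑ i ∈ S, (V (T.b i) - V (T.a i)) ≤ V d - V 0 := by
  classical
  induction S using Finset.induction_on_max_value T.b generalizing d with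
  | empty => simpa using hV zero_mem_Icc hd hd.1
  | insert i S hi hmax ih =>
    rw [Finset.sum_insert hi]
    have hai := T.Icc_subset i (left_mem_Icc.2 (T.lt i).le)
    have hbi := T.Icc_subset i (right_mem_Icc.2 (T.lt i).le)
    have h1 := ih hai fun j hj => by
      by_contra! hlt
      have hne : j ≠ i := fun h => hi (h ▸ hj)
      have := (Ioo_disjoint_Ioo.1 (T.disj hne))
      rw [min_eq_left (hmax j hj)] at this
      exact absurd this (not_le.2 (max_lt (T.lt j) hlt))
    have h2 := hV hbi hd (hS i (Finset.mem_insert_self i S))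
    linarith

theorem sum_word_sub_le (T : PCT) : ∀ (n : ℕ) {V : ℝ → ℝ}, MonotoneOn V (Icc 0 1) →
    ∀ S : Finset (Word n), ∑ w ∈ S, (V (T.wordInv n w 1) - V (T.wordInv n w 0)) ≤ V 1 - V 0
  | 0, V, hV, S => by
    have h0 : 0 ≤ V 1 - V 0 := sub_nonneg.2 (hV zero_mem_Icc one_mem_Icc zero_le_one)
    have hc : S.card ≤ 1 :=
      Finset.card_le_one.2 fun a _ b _ => Subsingleton.elim (α := Unit) a b
    simp only [wordInv, Finset.sum_const, nsmul_eq_mul]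
    exact mul_le_of_le_one_left h0 (by exact_mod_cast hc)
  | n + 1, V, hV, S => by
    classical
    have hmem : ∀ (w : Word n) {y : ℝ}, y ∈ Icc (0:ℝ) 1 → T.wordInv n w y ∈ Icc (0:ℝ) 1 :=
      fun w _ hy => (T.isConcaveBranch_word n w).mapsTo hy
    have hmono : ∀ i, MonotoneOn (fun y => V (T.invBranch i y)) (Icc 0 1) := fun i =>
      hV.comp (T.isConcaveBranch i).monotoneOn (T.isConcaveBranch i).mapsTo
    let S₁ : Finset ℕ := S.image fun w => w.1
    let S₂ : Finset (Word n) := S.image fun w => w.2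
    have hsub : S ⊆ S₁ ×ˢ S₂ := fun w hw => Finset.mem_product.2
      ⟨Finset.mem_image_of_mem (fun w : Word (n + 1) => w.1) hw,
        Finset.mem_image_of_mem (fun w : Word (n + 1) => w.2) hw⟩
    refine (Finset.sum_le_sum_of_subset_of_nonneg hsub fun w _ _ => ?_).trans ?_
    · exact sub_nonneg.2 (hmono w.1 (hmem w.2 zero_mem_Icc) (hmem w.2 one_mem_Icc)
        ((T.isConcaveBranch_word n w.2).monotoneOn zero_mem_Icc one_mem_Icc zero_le_one))
    · refine (Finset.sum_product S₁ S₂ _).trans_le ?_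
      refine le_trans (Finset.sum_le_sum fun i _ => T.sum_word_sub_le n (hmono i) S₂) ?_
      refine le_trans (Finset.sum_le_sum fun i _ => ?_)
        (T.sum_sub_le_of_monotoneOn hV S₁ one_mem_Icc fun i _ =>
          (T.Icc_subset i (right_mem_Icc.2 (T.lt i).le)).2)
      have hb := T.Icc_subset i (right_mem_Icc.2 (T.lt i).le)
      have := hV ((T.isConcaveBranch i).mapsTo one_mem_Icc) hb
        (invBranch_mem (T := T) (i := i) zero_le_one).2
      simp only [invBranch_zero]
      linarith

/-- A branch starting at the origin is expanding. -/
theorem inv_da_lt_one (T : PCT) {i : ℕ} (hi : T.a i = 0) : 1 / T.da i < 1 := by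
  rw [div_lt_one (T.da_pos i)]
  have hdisj : ∀ j, j ≠ i → T.b i ≤ T.a j := by
    intro j hj
    have h := Ioo_disjoint_Ioo.1 (T.disj hj.symm)
    rw [hi, max_eq_right (T.a_nonneg j)] at h
    rcases min_le_iff.1 h with h | h
    · exact h
    · exact absurd (T.lt j) h.not_gt
  have hb : 0 < T.b i := hi ▸ T.lt i
  by_cases hacc : AccPt (0:ℝ) (𝓟 (range T.a))
  · obtain ⟨_, ⟨hlt, j, rfl⟩, hne⟩ := (accPt_iff_nhds.1 hacc) _ (Iio_mem_nhds hb)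
    have hji : j ≠ i := fun h => hne (h ▸ hi)
    exact absurd (hdisj j hji) (not_le.2 hlt)
  · obtain ⟨j, hj, hd⟩ := T.expand hacc
    by_cases hji : j = i
    · exact hji ▸ hd
    · exact absurd (hdisj j hji) (not_le.2 (hj.symm ▸ hb))

/-- Every branch is uniformly expanding or starts uniformly away from the origin. -/
theorem exists_inv_da_le_or_le_a (T : PCT) :
    ∃ t : ℝ, 0 < t ∧ t < 1 ∧ ∀ i, 1 / T.da i ≤ 1 - t ∨ t ≤ T.a i := by
  have hfin : {i | ¬ 1 / T.da i ≤ 1 / 2}.Finite := by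
    have := T.sum_inv.tendsto_cofinite_zero.eventually (ge_mem_nhds (by norm_num : (0:ℝ) < 1 / 2))
    exact Filter.eventually_cofinite.1 this
  have h1 : ∀ᶠ t in 𝓝[>] (0:ℝ), ∀ i ∈ {i | ¬ 1 / T.da i ≤ 1 / 2},
      1 / T.da i ≤ 1 - t ∨ t ≤ T.a i := by
    rw [Filter.eventually_all_finite hfin]
    intro i _
    rcases (T.a_nonneg i).eq_or_lt with h | h
    · filter_upwards [Ioo_mem_nhdsGT (sub_pos.2 (T.inv_da_lt_one h.symm))] with t ht
      left; linarith [ht.2]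
    · filter_upwards [Ioo_mem_nhdsGT h] with t ht
      exact Or.inr ht.2.le
  obtain ⟨t, ht, ht'⟩ := (h1.and (Ioo_mem_nhdsGT (by norm_num : (0:ℝ) < 1 / 2))).exists
  refine ⟨t, ht'.1, by linarith [ht'.2], fun i => ?_⟩
  by_cases hi : 1 / T.da i ≤ 1 / 2
  · left; linarith [ht'.2]
  · exact ht i hi

/-- The weights of the branches of `τ^n` tend to zero uniformly: the quantity
`H * (H / (x + η)) ^ q`, with `H` the weight and `x` the left endpoint of the branch, is
contracted each time a letter is added. -/
theorem exists_wordWeight_le (T : PCT) {ε : ℝ} (hε : 0 < ε) :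
    ∃ n, ∀ w : Word n, T.wordWeight n w 0 ≤ ε := by
  obtain ⟨t, ht0, ht1, ht⟩ := T.exists_inv_da_le_or_le_a
  set K : ℝ := 1 + ∑' j, 1 / T.da j with hK
  have hK1 : 1 ≤ K := le_add_of_nonneg_right (tsum_nonneg T.inv_da_nonneg)
  have hK0 : 0 < K := zero_lt_one.trans_le hK1
  have hKi : ∀ i, 1 / T.da i ≤ K := fun i => (T.inv_da_le_tsum i).trans (by rw [hK]; linarith)
  set η : ℝ := t / (2 * K) with hη
  have hη0 : 0 < η := by positivity
  have hηK : η * K = t / 2 := by rw [hη]; field_simp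
  have hη1 : η ≤ 1 := by rw [hη, div_le_one (by positivity)]; linarith
  obtain ⟨q, hq⟩ := exists_pow_lt_of_lt_one (show 0 < (1 - t) / K by
    have := sub_pos.2 ht1; positivity) (show 1 - t / 4 < 1 by linarith)
  rw [lt_div_iff₀ hK0] at hq
  have hstep : ∀ i, ∀ x ∈ Icc (0:ℝ) 1,
      T.weight i x * (T.weight i x * (x + η) / (T.invBranch i x + η)) ^ q ≤ 1 - t := by
    intro i x hx
    have hB := T.isConcaveBranch i
    have hw0 := hB.nonneg x hx
    have hw1 : T.weight i x ≤ 1 / T.da i := weight_le hx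
    have hψ := hB.mapsTo hx
    have hlow := hB.lower 0 zero_mem_Icc x hx hx.1
    rw [invBranch_zero, sub_zero] at hlow
    have hden : 0 < T.invBranch i x + η := by linarith [hψ.1]
    have hr0 : 0 ≤ T.weight i x * (x + η) / (T.invBranch i x + η) := by
      have := hx.1; positivity
    rcases ht i with hi | hi
    · have hw : T.weight i x ≤ 1 - t := hw1.trans hi
      refine (mul_le_of_le_one_right hw0 (pow_le_one₀ hr0 ?_)).trans hw
      rw [div_le_one hden, mul_add]
      have : T.weight i x * η ≤ η := mul_le_of_le_one_left hη0.le (by linarith)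
      linarith [T.a_nonneg i]
    · have hwK : T.weight i x ≤ K := hw1.trans (hKi i)
      have hr : T.weight i x * (x + η) / (T.invBranch i x + η) ≤ 1 - t / 4 := by
        rw [div_le_iff₀ hden, mul_add]
        have h1 : T.weight i x * η ≤ t / 2 := by
          rw [← hηK, mul_comm]; exact mul_le_mul_of_nonneg_left hwK hη0.le
        nlinarith [hψ.2]
      calc _ ≤ K * (1 - t / 4) ^ q := by gcongr
        _ ≤ 1 - t := by linarith
  have hQ : ∀ (n : ℕ) (w : Word n), T.wordWeight n w 0 *
      (T.wordWeight n w 0 / (T.wordInv n w 0 + η)) ^ q ≤ (1 - t) ^ n * (1 / η) ^ q := by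
    intro n
    induction n with
    | zero => intro w; simp [wordWeight, wordInv]
    | succ n ih =>
      intro w
      have hH := T.wordWeight_zero_nonneg n w.2
      have hx := (T.isConcaveBranch_word n w.2).mapsTo zero_mem_Icc
      have hy := (T.isConcaveBranch w.1).mapsTo hx
      have h1 := hstep w.1 _ hx
      have h2 := ih w.2
      simp only [wordWeight, wordInv]
      set x := T.wordInv n w.2 0
      set H := T.wordWeight n w.2 0
      set g := T.weight w.1 x
      set y := T.invBranch w.1 x
      have hxη : 0 < x + η := by linarith [hx.1]
      have hyη : 0 < y + η := by linarith [hy.1]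
      have heq : g * H * (g * H / (y + η)) ^ q =
          (g * (g * (x + η) / (y + η)) ^ q) * (H * (H / (x + η)) ^ q) := by
        have : g * H / (y + η) = (g * (x + η) / (y + η)) * (H / (x + η)) := by
          field_simp
        rw [this, mul_pow]; ring
      rw [heq, pow_succ', mul_assoc (1 - t)]
      exact mul_le_mul h1 h2 (by positivity) (by linarith)
  obtain ⟨n, hn⟩ := exists_pow_lt_of_lt_one
    (show 0 < (ε * (ε / 2) ^ q) / (1 / η) ^ q by positivity) (show 1 - t < 1 by linarith)
  rw [lt_div_iff₀ (by positivity)] at hn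
  refine ⟨n, fun w => ?_⟩
  by_contra! hlt
  refine absurd ((hQ n w).trans_lt hn) (not_lt.2 ?_)
  have hx := (T.isConcaveBranch_word n w).mapsTo zero_mem_Icc
  have hxη : 0 < T.wordInv n w 0 + η := by linarith [hx.1]
  have hle : ε / 2 ≤ T.wordWeight n w 0 / (T.wordInv n w 0 + η) :=
    div_le_div₀ (hε.le.trans hlt.le) hlt.le hxη (by linarith [hx.2])
  exact mul_le_mul hlt.le (pow_le_pow_left₀ (by positivity) hle q) (by positivity)
    (hε.le.trans hlt.le)

end PCT

namespace PCT

variable {T : PCT} {f : ℝ → ℝ} {M : ℝ}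

/-- The map `τ`, redefined as `0` off the branches so as to be measurable. -/
noncomputable def regMap (T : PCT) : ℝ → ℝ :=
  (⋃ i, Ioo (T.a i) (T.b i)).indicator T.τ

theorem regMap_of_mem {i : ℕ} {x : ℝ} (hx : x ∈ Ioo (T.a i) (T.b i)) : T.regMap x = T.τ x :=
  indicator_of_mem (mem_iUnion.2 ⟨i, hx⟩) _

theorem measurable_regMap (T : PCT) : Measurable T.regMap := by
  classical
  rw [regMap, ← piecewise_eq_indicator]
  refine ContinuousOn.measurable_piecewise ?_ continuousOn_const
    (MeasurableSet.iUnion fun i => measurableSet_Ioo)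
  intro x hx
  obtain ⟨i, hi⟩ := mem_iUnion.1 hx
  exact (T.diff i x hi).continuousAt.continuousWithinAt

theorem mapsTo_regMap (T : PCT) : MapsTo T.regMap (Icc 0 1) (Icc 0 1) := by
  intro x hx
  by_cases h : x ∈ ⋃ i, Ioo (T.a i) (T.b i)
  · rw [regMap, indicator_of_mem h]; exact T.maps_to hx
  · rw [regMap, indicator_of_notMem h]; exact zero_mem_Icc

theorem ae_mem_iUnion_Ioo (T : PCT) :
    ∀ᵐ x ∂volume.restrict (Icc (0:ℝ) 1), x ∈ ⋃ i, Ioo (T.a i) (T.b i) := by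
  rw [ae_restrict_iff' measurableSet_Icc, ae_iff]
  convert T.null using 2
  ext x; simp [and_assoc]

theorem regMap_ae_eq (T : PCT) : T.regMap =ᵐ[volume.restrict (Icc (0:ℝ) 1)] T.τ := by
  filter_upwards [T.ae_mem_iUnion_Ioo] with x hx
  exact indicator_of_mem hx _

/-- The contribution of the `i`-th branch to the Frobenius–Perron operator. -/
noncomputable def branchTerm (T : PCT) (f : ℝ → ℝ) (i : ℕ) (y : ℝ) : ℝ :=
  f (T.invBranch i y) * T.weight i y

theorem branchTerm_τ {i : ℕ} {x : ℝ} (hx : x ∈ Ioo (T.a i) (T.b i)) :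
    |deriv T.τ x| • T.branchTerm f i (T.τ x) = f x := by
  have hd := branchDeriv_pos (Ioo_subset_Ico_self hx)
  rw [branchTerm, ← branch_of_mem hx, invBranch_branch (Ioo_subset_Ico_self hx),
    weight_branch (Ioo_subset_Ico_self hx)]
  rw [branchDeriv_of_mem hx] at hd ⊢
  rw [abs_of_pos hd, smul_eq_mul]
  field_simp

theorem ae_branchTerm_eq_zero (T : PCT) (f : ℝ → ℝ) (i : ℕ) {A : Set ℝ} (hA : A ⊆ Icc 0 1) :
    ∀ᵐ y, y ∈ A \ (T.τ '' (Ioo (T.a i) (T.b i) ∩ T.regMap ⁻¹' A)) → T.branchTerm f i y = 0 := by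
  filter_upwards [Measure.ae_ne volume 0] with y hy0 hy
  rcases exists_branch_eq_or (T := T) (i := i) (hA hy.1).1 with ⟨x, hx, rfl⟩ | ⟨-, -, h⟩
  · exfalso
    rcases hx.1.eq_or_lt with rfl | h
    · exact hy0 branch_left
    · have hx' : x ∈ Ioo (T.a i) (T.b i) := ⟨h, hx.2⟩
      rw [branch_of_mem hx'] at hy
      exact hy.2 ⟨x, ⟨hx', by rw [mem_preimage, regMap_of_mem hx']; exact hy.1⟩, rfl⟩
  · rw [branchTerm, h, mul_zero]

section

variable {i : ℕ} {A : Set ℝ}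

theorem measurableSet_Ioo_inter_preimage (hA : MeasurableSet A) :
    MeasurableSet (Ioo (T.a i) (T.b i) ∩ T.regMap ⁻¹' A) :=
  measurableSet_Ioo.inter (T.measurable_regMap hA)

theorem hasDerivWithinAt_τ : ∀ x ∈ Ioo (T.a i) (T.b i) ∩ T.regMap ⁻¹' A,
    HasDerivWithinAt T.τ (deriv T.τ x) (Ioo (T.a i) (T.b i) ∩ T.regMap ⁻¹' A) x :=
  fun x hx => (T.diff i x hx.1).hasDerivAt.hasDerivWithinAt

theorem injOn_τ : InjOn T.τ (Ioo (T.a i) (T.b i) ∩ T.regMap ⁻¹' A) :=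
  (T.mono i).injOn.mono inter_subset_left

theorem integrableOn_branchTerm (hf : IntegrableOn f (Icc 0 1)) :
    IntegrableOn (T.branchTerm f i) (Icc 0 1) := by
  refine IntegrableOn.of_ae_sdiff_eq_zero ?_ measurableSet_Icc.nullMeasurableSet
    (T.ae_branchTerm_eq_zero f i Subset.rfl)
  have hs := measurableSet_Ioo_inter_preimage (T := T) (i := i)
    (measurableSet_Icc (a := (0:ℝ)) (b := 1))
  rw [integrableOn_image_iff_integrableOn_abs_deriv_smul hs hasDerivWithinAt_τ injOn_τ]
  exact (hf.mono_set (inter_subset_left.trans (T.sub i))).congr_fun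
    (fun x hx => (branchTerm_τ hx.1).symm) hs

theorem setIntegral_branchTerm (f : ℝ → ℝ) (hA : MeasurableSet A) (hA1 : A ⊆ Icc 0 1) :
    ∫ y in A, T.branchTerm f i y = ∫ x in Ioo (T.a i) (T.b i) ∩ T.regMap ⁻¹' A, f x := by
  have hs := measurableSet_Ioo_inter_preimage (T := T) (i := i) hA
  have hsub : T.τ '' (Ioo (T.a i) (T.b i) ∩ T.regMap ⁻¹' A) ⊆ A := by
    rintro _ ⟨x, hx, rfl⟩
    rw [← regMap_of_mem hx.1]; exact hx.2
  rw [setIntegral_eq_of_subset_of_ae_sdiff_eq_zero hA.nullMeasurableSet hsub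
    (T.ae_branchTerm_eq_zero f i hA1),
    integral_image_eq_integral_abs_deriv_smul hs hasDerivWithinAt_τ injOn_τ]
  exact setIntegral_congr_fun hs fun x hx => branchTerm_τ hx.1

end

theorem abs_branchTerm_le (hM : ∀ x ∈ Icc (0:ℝ) 1, |f x| ≤ M) (i : ℕ) {y : ℝ}
    (hy : y ∈ Icc (0:ℝ) 1) : |T.branchTerm f i y| ≤ M * (1 / T.da i) := by
  have hB := T.isConcaveBranch i
  rw [branchTerm, abs_mul, abs_of_nonneg (hB.nonneg y hy)]
  exact mul_le_mul (hM _ (hB.mapsTo hy)) (weight_le hy) (hB.nonneg y hy)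
    ((abs_nonneg _).trans (hM y hy))

theorem summable_branchTerm (hM : ∀ x ∈ Icc (0:ℝ) 1, |f x| ≤ M) {y : ℝ}
    (hy : y ∈ Icc (0:ℝ) 1) : Summable fun i => T.branchTerm f i y :=
  (T.sum_inv.mul_left M).of_norm_bounded fun i => abs_branchTerm_le hM i hy

/-- The Frobenius–Perron operator of `τ`, as an explicit sum over branches. -/
noncomputable def transfer (T : PCT) (f : ℝ → ℝ) (y : ℝ) : ℝ := ∑' i, T.branchTerm f i y

theorem abs_transfer_le (hM : ∀ x ∈ Icc (0:ℝ) 1, |f x| ≤ M) {y : ℝ} (hy : y ∈ Icc (0:ℝ) 1) :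
    |T.transfer f y| ≤ M * ∑' i, 1 / T.da i :=
  tsum_of_norm_bounded (f := fun i => T.branchTerm f i y) (T.sum_inv.hasSum.mul_left M)
    fun i => abs_branchTerm_le hM i hy

theorem integrableOn_transfer (hf : IntegrableOn f (Icc 0 1))
    (hM : ∀ x ∈ Icc (0:ℝ) 1, |f x| ≤ M) : IntegrableOn (T.transfer f) (Icc 0 1) := by
  have hmeas : AEStronglyMeasurable (T.transfer f) (volume.restrict (Icc (0:ℝ) 1)) := by
    refine aestronglyMeasurable_of_tendsto_ae atTop
      (f := fun n y => ∑ i ∈ Finset.range n, T.branchTerm f i y) (fun n => ?_) ?_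
    · exact (integrable_finsetSum _ fun i _ => integrableOn_branchTerm hf).aestronglyMeasurable
    · filter_upwards [ae_restrict_mem measurableSet_Icc] with y hy
      exact (summable_branchTerm hM hy).hasSum.tendsto_sum_nat
  refine Integrable.of_bound hmeas (M * ∑' i, 1 / T.da i) ?_
  filter_upwards [ae_restrict_mem measurableSet_Icc] with y hy
  exact abs_transfer_le hM hy

theorem setIntegral_transfer (hf : IntegrableOn f (Icc 0 1))
    (hM : ∀ x ∈ Icc (0:ℝ) 1, |f x| ≤ M) {A : Set ℝ} (hA : MeasurableSet A) (hA1 : A ⊆ Icc 0 1) :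
    ∫ y in A, T.transfer f y = ∫ x in T.regMap ⁻¹' A ∩ Icc 0 1, f x := by
  have hAfin : volume A < ⊤ := (measure_mono hA1).trans_lt (by simp)
  have h1 : HasSum (fun i => ∫ y in A, T.branchTerm f i y) (∫ y in A, T.transfer f y) := by
    refine hasSum_integral_of_summable_integral_norm
      (fun i => (integrableOn_branchTerm hf).mono_set hA1) ?_
    refine ((T.sum_inv.mul_left M).mul_right (volume.real A)).of_nonneg_of_le
      (fun i => integral_nonneg fun y => norm_nonneg _) fun i => ?_
    refine (Real.le_norm_self _).trans
      (norm_setIntegral_le_of_norm_le_const hAfin fun y hy => ?_)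
    rw [norm_norm]
    exact abs_branchTerm_le hM i (hA1 hy)
  have h2 := hasSum_integral_iUnion (μ := volume) (f := f)
    (fun i => measurableSet_Ioo_inter_preimage (T := T) (i := i) hA)
    (fun i j hij => (T.disj hij).mono inter_subset_left inter_subset_left)
    (hf.mono_set (iUnion_subset fun i => inter_subset_left.trans (T.sub i)))
  simp only [setIntegral_branchTerm f hA hA1] at h1
  rw [h1.unique h2, ← iUnion_inter]
  refine setIntegral_congr_set ?_
  have h3 := (ae_restrict_iff' measurableSet_Icc).1 T.ae_mem_iUnion_Ioo
  refine eventuallyEq_set.2 ?_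
  filter_upwards [h3] with x hx
  refine ⟨fun h => ⟨h.2, ?_⟩, fun h => ⟨hx h.2, h.1⟩⟩
  obtain ⟨i, hi⟩ := mem_iUnion.1 h.1
  exact T.sub i hi

theorem quasiMeasurePreserving_regMap (T : PCT) :
    Measure.QuasiMeasurePreserving T.regMap (volume.restrict (Icc (0:ℝ) 1))
      (volume.restrict (Icc (0:ℝ) 1)) := by
  refine ⟨T.measurable_regMap, Measure.AbsolutelyContinuous.mk fun A hA h0 => ?_⟩
  rw [Measure.map_apply T.measurable_regMap hA, Measure.restrict_apply (T.measurable_regMap hA)]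
  rw [Measure.restrict_apply hA] at h0
  have h := setIntegral_transfer (T := T) (f := fun _ => 1) (M := 1) (by simp) (by simp)
    (hA.inter measurableSet_Icc) inter_subset_right
  rw [setIntegral_measure_zero _ h0] at h
  have hset : T.regMap ⁻¹' (A ∩ Icc 0 1) ∩ Icc 0 1 = T.regMap ⁻¹' A ∩ Icc 0 1 := by
    ext x
    exact ⟨fun h => ⟨h.1.1, h.2⟩, fun h => ⟨⟨h.1, T.mapsTo_regMap h.2⟩, h.2⟩⟩
  rw [hset, setIntegral_const, smul_eq_mul, mul_one] at h
  exact (measureReal_eq_zero_iff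
    ((measure_mono inter_subset_right).trans_lt (by simp : volume (Icc (0:ℝ) 1) < ⊤)).ne).1 h.symm

theorem iterate_regMap_ae_eq (T : PCT) (n : ℕ) :
    T.regMap^[n] =ᵐ[volume.restrict (Icc (0:ℝ) 1)] T.τ^[n] := by
  induction n with
  | zero => rfl
  | succ n ih =>
    filter_upwards [T.quasiMeasurePreserving_regMap.ae ih, T.regMap_ae_eq] with x h1 h2
    rw [Function.iterate_succ_apply, Function.iterate_succ_apply, h1, h2]

theorem integrableOn_iterate_transfer (n : ℕ) (hf : IntegrableOn f (Icc 0 1))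
    (hM : ∀ x ∈ Icc (0:ℝ) 1, |f x| ≤ M) : IntegrableOn (T.transfer^[n] f) (Icc 0 1) := by
  induction n generalizing f M with
  | zero => exact hf
  | succ n ih => exact ih (integrableOn_transfer hf hM) fun x hx => abs_transfer_le hM hx

theorem setIntegral_iterate_transfer_regMap (n : ℕ) (hf : IntegrableOn f (Icc 0 1))
    (hM : ∀ x ∈ Icc (0:ℝ) 1, |f x| ≤ M) {A : Set ℝ} (hA : MeasurableSet A) (hA1 : A ⊆ Icc 0 1) :
    ∫ y in A, T.transfer^[n] f y = ∫ x in T.regMap^[n] ⁻¹' A ∩ Icc 0 1, f x := by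
  induction n generalizing f M with
  | zero =>
    simp only [Function.iterate_zero, id, preimage_id_eq]
    rw [inter_eq_left.2 hA1]
  | succ n ih =>
    have hm : MeasurableSet (T.regMap^[n] ⁻¹' A) := T.measurable_regMap.iterate n hA
    rw [Function.iterate_succ_apply, ih (integrableOn_transfer hf hM)
      (fun x hx => abs_transfer_le hM hx), setIntegral_transfer hf hM
      (hm.inter measurableSet_Icc) inter_subset_right]
    congr 2
    ext x
    simp only [mem_inter_iff, mem_preimage, Function.iterate_succ_apply]
    exact ⟨fun h => ⟨h.1.1, h.2⟩, fun h => ⟨⟨h.1, T.mapsTo_regMap h.2⟩, h.2⟩⟩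

theorem setIntegral_iterate_transfer (n : ℕ) (hf : IntegrableOn f (Icc 0 1))
    (hM : ∀ x ∈ Icc (0:ℝ) 1, |f x| ≤ M) {A : Set ℝ} (hA : MeasurableSet A) (hA1 : A ⊆ Icc 0 1) :
    ∫ y in A, T.transfer^[n] f y = ∫ x in T.τ^[n] ⁻¹' A ∩ Icc 0 1, f x := by
  rw [setIntegral_iterate_transfer_regMap n hf hM hA hA1]
  refine setIntegral_congr_set (eventuallyEq_set.2 ?_)
  filter_upwards [(ae_restrict_iff' measurableSet_Icc).1 (T.iterate_regMap_ae_eq n)] with x hx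
  exact and_congr_left fun h => by rw [mem_preimage, mem_preimage, hx h]

theorem abs_mul_wordWeight_le (n : ℕ) (hM : ∀ x ∈ Icc (0:ℝ) 1, |f x| ≤ M) (w : Word n) {y : ℝ}
    (hy : y ∈ Icc (0:ℝ) 1) :
    |f (T.wordInv n w y) * T.wordWeight n w y| ≤ M * T.wordWeight n w 0 := by
  have hB := T.isConcaveBranch_word n w
  rw [abs_mul, abs_of_nonneg (hB.nonneg y hy)]
  exact mul_le_mul (hM _ (hB.mapsTo hy)) (hB.le_zero hy) (hB.nonneg y hy)
    ((abs_nonneg _).trans (hM y hy))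

theorem summable_mul_wordWeight (n : ℕ) (hM : ∀ x ∈ Icc (0:ℝ) 1, |f x| ≤ M) {y : ℝ}
    (hy : y ∈ Icc (0:ℝ) 1) :
    Summable fun w : Word n => f (T.wordInv n w y) * T.wordWeight n w y :=
  ((T.summable_wordWeight_zero n).mul_left M).of_norm_bounded fun w =>
    abs_mul_wordWeight_le n hM w hy

/-- The iterates of the Frobenius–Perron operator, as a sum over branches of `τ^n`. -/
theorem iterate_transfer_eq_tsum (n : ℕ) (hM : ∀ x ∈ Icc (0:ℝ) 1, |f x| ≤ M) {y : ℝ}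
    (hy : y ∈ Icc (0:ℝ) 1) :
    T.transfer^[n] f y = ∑' w : Word n, f (T.wordInv n w y) * T.wordWeight n w y := by
  induction n generalizing f M with
  | zero =>
    have h : ∑' _ : Unit, f y * 1 = f y := by simp
    exact h.symm
  | succ n ih =>
    rw [Function.iterate_succ_apply, ih fun x hx => abs_transfer_le hM hx]
    have hs : Summable fun p : Word n × ℕ =>
        f (T.wordInv (n + 1) (p.2, p.1) y) * T.wordWeight (n + 1) (p.2, p.1) y :=
      (Equiv.prodComm (Word n) ℕ).summable_iff.2 (summable_mul_wordWeight (T := T) (n + 1) hM hy)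
    refine Eq.trans ?_ ((Equiv.prodComm (Word n) ℕ).tsum_eq fun w : ℕ × Word n =>
      f (T.wordInv (n + 1) w y) * T.wordWeight (n + 1) w y)
    refine Eq.trans ?_ (hs.tsum_prod' fun w => hs.prod_factor w).symm
    refine tsum_congr fun w => ?_
    rw [transfer, ← tsum_mul_right]
    exact tsum_congr fun i => mul_assoc _ _ _

end PCT

/-- The increments of `f` on `[0,1]` are controlled by those of `V`. -/
def IncrementLE (f V : ℝ → ℝ) : Prop :=
  ∀ x ∈ Icc (0:ℝ) 1, ∀ y ∈ Icc (0:ℝ) 1, x ≤ y → |f y - f x| ≤ V y - V x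

namespace IncrementLE

variable {f V : ℝ → ℝ}

theorem monotoneOn (hV : IncrementLE f V) : MonotoneOn V (Icc 0 1) := fun x hx y hy hxy =>
  sub_nonneg.1 ((abs_nonneg _).trans (hV x hx y hy hxy))

theorem eVariationOn_le (hV : IncrementLE f V) :
    eVariationOn f (Icc 0 1) ≤ ENNReal.ofReal (V 1 - V 0) := by
  have h1 := hV.monotoneOn.eVariationOn_eq PCT.zero_mem_Icc PCT.one_mem_Icc
  rw [inter_self] at h1
  refine le_trans (iSup_mono fun p => Finset.sum_le_sum fun i _ => ?_) h1.le
  have h2 := hV _ (p.2.2.2 i) _ (p.2.2.2 (i + 1)) (p.2.2.1 i.le_succ)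
  rw [edist_dist, edist_dist, Real.dist_eq, Real.dist_eq]
  exact ENNReal.ofReal_le_ofReal (h2.trans (le_abs_self _))

theorem sum {ι : Type*} {u G : ι → ℝ → ℝ} (S : Finset ι) (h : ∀ i, IncrementLE (u i) (G i)) :
    IncrementLE (fun x => ∑ i ∈ S, u i x) (fun x => ∑ i ∈ S, G i x) := by
  intro x hx y hy hxy
  rw [← Finset.sum_sub_distrib, ← Finset.sum_sub_distrib]
  exact (Finset.abs_sum_le_sum_abs _ _).trans
    (Finset.sum_le_sum fun i _ => h i x hx y hy hxy)

/-- A function is bounded on an interval by its variation plus its average there. -/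
theorem abs_le (hV : IncrementLE f V) (hf : IntegrableOn f (Icc 0 1)) {c d x : ℝ}
    (hc : c ∈ Icc (0:ℝ) 1) (hd : d ∈ Icc (0:ℝ) 1) (hcd : c < d) (hx : x ∈ Icc c d) :
    |f x| ≤ (V d - V c) + (d - c)⁻¹ * ∫ t in Icc (0:ℝ) 1, |f t| := by
  have hsub : Icc c d ⊆ Icc (0:ℝ) 1 := Icc_subset_Icc hc.1 hd.2
  have hpt : ∀ t ∈ Icc c d, |f x| - (V d - V c) ≤ |f t| := by
    intro t ht
    have hmx := hV.monotoneOn hc (hsub hx) hx.1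
    have hmx' := hV.monotoneOn (hsub hx) hd hx.2
    have hmt := hV.monotoneOn hc (hsub ht) ht.1
    have hmt' := hV.monotoneOn (hsub ht) hd ht.2
    rcases le_total t x with h | h
    · have := hV t (hsub ht) x (hsub hx) h
      linarith [abs_sub_abs_le_abs_sub (f x) (f t)]
    · have := hV x (hsub hx) t (hsub ht) h
      rw [abs_sub_comm] at this
      linarith [abs_sub_abs_le_abs_sub (f x) (f t)]
  have h1 : (d - c) * (|f x| - (V d - V c)) ≤ ∫ t in Icc c d, |f t| := by
    have := setIntegral_mono_on (integrableOn_const (by simp)) (hf.mono_set hsub).abs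
      measurableSet_Icc hpt
    rwa [setIntegral_const, smul_eq_mul, Real.volume_real_Icc_of_le hcd.le] at this
  have h2 : ∫ t in Icc c d, |f t| ≤ ∫ t in Icc (0:ℝ) 1, |f t| :=
    setIntegral_mono_set hf.abs (ae_of_all _ fun t => abs_nonneg _) hsub.eventuallyLE
  have h3 : |f x| - (V d - V c) ≤ (d - c)⁻¹ * ∫ t in Icc (0:ℝ) 1, |f t| := by
    rw [← div_eq_inv_mul, le_div_iff₀' (sub_pos.2 hcd)]
    exact h1.trans h2
  linarith

/-- Control of the increments of the contribution of one inverse branch. -/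
theorem mul_comp (hV : IncrementLE f V) {ψ h : ℝ → ℝ} (H : IsConcaveBranch ψ h) {S : ℝ}
    (hS : ∀ y ∈ Icc (0:ℝ) 1, |f (ψ y)| ≤ S) :
    IncrementLE (fun y => f (ψ y) * h y) (fun y => h 0 * V (ψ y) - S * h y) := by
  intro x hx y hy hxy
  have h1 := hV _ (H.mapsTo hx) _ (H.mapsTo hy) (H.monotoneOn hx hy hxy)
  have h2 : 0 ≤ h x - h y := sub_nonneg.2 (H.antitoneOn hx hy hxy)
  have h3 : f (ψ y) * h y - f (ψ x) * h x =
      (f (ψ y) - f (ψ x)) * h x + f (ψ y) * (h y - h x) := by ring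
  have h4 : |(f (ψ y) - f (ψ x)) * h x| ≤ (V (ψ y) - V (ψ x)) * h 0 := by
    rw [abs_mul, abs_of_nonneg (H.nonneg x hx)]
    exact mul_le_mul h1 (H.le_zero hx) (H.nonneg x hx) ((abs_nonneg _).trans h1)
  have h5 : |f (ψ y) * (h y - h x)| ≤ S * (h x - h y) := by
    rw [abs_mul, abs_sub_comm, abs_of_nonneg h2]
    exact mul_le_mul_of_nonneg_right (hS y hy) h2
  rw [h3]
  linarith [abs_add_le ((f (ψ y) - f (ψ x)) * h x) (f (ψ y) * (h y - h x))]

end IncrementLE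

theorem BoundedVariationOn.incrementLE {f : ℝ → ℝ} (hf : BoundedVariationOn f (Icc (0:ℝ) 1)) :
    IncrementLE f (variationOnFromTo f (Icc 0 1) 0) := by
  intro x hx y hy hxy
  have hl := hf.locallyBoundedVariationOn
  rw [variationOnFromTo.sub_right hl PCT.zero_mem_Icc hy hx, variationOnFromTo.eq_of_le _ _ hxy,
    ← Real.dist_eq, dist_edist]
  exact ENNReal.toReal_mono (hl x y hx hy)
    (eVariationOn.edist_le f ⟨hy, hxy, le_rfl⟩ ⟨hx, le_rfl, hxy⟩)

namespace PCT

variable {T : PCT} {f V : ℝ → ℝ}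

/-- The contribution of one branch of `τ^n`, with the constant adapted to the length of its
domain. -/
theorem incrementLE_word (hV : IncrementLE f V) (hf : IntegrableOn f (Icc 0 1)) (n : ℕ)
    (w : Word n) :
    IncrementLE (fun y => f (T.wordInv n w y) * T.wordWeight n w y)
      (fun y => T.wordWeight n w 0 * V (T.wordInv n w y) -
        (V (T.wordInv n w 1) - V (T.wordInv n w 0) + (T.wordInv n w 1 - T.wordInv n w 0)⁻¹ *
          ∫ t in Icc (0:ℝ) 1, |f t|) * T.wordWeight n w y) := by
  have H := T.isConcaveBranch_word n w
  have hm : ∀ {y}, y ∈ Icc (0:ℝ) 1 →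
      T.wordInv n w y ∈ Icc (T.wordInv n w 0) (T.wordInv n w 1) := fun hy =>
    ⟨H.monotoneOn zero_mem_Icc hy hy.1, H.monotoneOn hy one_mem_Icc hy.2⟩
  rcases (hm zero_mem_Icc).2.eq_or_lt with h | h
  · have h0 : ∀ y ∈ Icc (0:ℝ) 1, T.wordWeight n w y = 0 := fun y hy =>
      le_antisymm ((H.le_zero hy).trans_eq
        (H.flat 0 zero_mem_Icc 1 one_mem_Icc zero_lt_one h)) (H.nonneg y hy)
    intro x hx y hy _
    simp [h0 x hx, h0 y hy, h0 0 zero_mem_Icc]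
  · exact hV.mul_comp H fun y hy =>
      hV.abs_le hf (H.mapsTo zero_mem_Icc) (H.mapsTo one_mem_Icc) h (hm hy)

theorem abs_le_of_incrementLE (hV : IncrementLE f V) (hf : IntegrableOn f (Icc 0 1)) :
    ∀ x ∈ Icc (0:ℝ) 1, |f x| ≤ (V 1 - V 0) + ∫ t in Icc (0:ℝ) 1, |f t| := fun x hx => by
  simpa using hV.abs_le hf zero_mem_Icc one_mem_Icc zero_lt_one hx

/-- The variation part of the Lasota–Yorke inequality. -/
theorem exists_eVariationOn_iterate_transfer_le (T : PCT) :
    ∃ (n : ℕ) (C : ℝ), 0 ≤ C ∧ ∀ f V : ℝ → ℝ, IncrementLE f V → IntegrableOn f (Icc 0 1) →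
      eVariationOn (T.transfer^[n] f) (Icc 0 1) ≤
        ENNReal.ofReal (1 / 2 * (V 1 - V 0) + C * ∫ x in Icc (0:ℝ) 1, |f x|) := by
  classical
  obtain ⟨n, hn⟩ := T.exists_wordWeight_le (ε := 1 / 6) (by norm_num)
  obtain ⟨F, hF⟩ := summable_iff_vanishing_norm.1 (T.summable_wordWeight_zero n) (1 / 6)
    (by norm_num)
  set c : Word n → ℝ := fun w => (T.wordInv n w 1 - T.wordInv n w 0)⁻¹ with hc
  have hle : ∀ w, T.wordInv n w 0 ≤ T.wordInv n w 1 := fun w =>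
    (T.isConcaveBranch_word n w).monotoneOn zero_mem_Icc one_mem_Icc zero_le_one
  have hc0 : ∀ w, 0 ≤ c w := fun w => inv_nonneg.2 (sub_nonneg.2 (hle w))
  set C₁ : ℝ := ∑ w ∈ F, T.wordWeight n w 0 * c w with hC₁
  have hC₁0 : 0 ≤ C₁ :=
    Finset.sum_nonneg fun w _ => mul_nonneg (T.wordWeight_zero_nonneg n w) (hc0 w)
  refine ⟨n, C₁ + 1 / 6, by positivity, fun f V hV hf => ?_⟩
  set N : ℝ := ∫ x in Icc (0:ℝ) 1, |f x| with hN
  have hN0 : 0 ≤ N := integral_nonneg fun x => abs_nonneg _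
  have hW0 : 0 ≤ V 1 - V 0 := sub_nonneg.2 (hV.monotoneOn zero_mem_Icc one_mem_Icc zero_le_one)
  have hM := abs_le_of_incrementLE hV hf
  set Δ : Word n → ℝ := fun w => V (T.wordInv n w 1) - V (T.wordInv n w 0) with hΔ
  have hΔ0 : ∀ w, 0 ≤ Δ w := fun w => sub_nonneg.2 (hV.monotoneOn
    ((T.isConcaveBranch_word n w).mapsTo zero_mem_Icc)
    ((T.isConcaveBranch_word n w).mapsTo one_mem_Icc) (hle w))
  set R : Word n → ℝ := fun w => if w ∈ F then Δ w + c w * N else V 1 - V 0 + N with hR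
  have hR0 : ∀ w, 0 ≤ R w := by
    intro w
    have := mul_nonneg (hc0 w) hN0
    simp only [hR]
    split_ifs
    · linarith [hΔ0 w]
    · linarith
  have hinc : ∀ w, IncrementLE (fun y => f (T.wordInv n w y) * T.wordWeight n w y)
      (fun y => T.wordWeight n w 0 * V (T.wordInv n w y) - R w * T.wordWeight n w y) := by
    intro w
    simp only [hR]
    split_ifs
    · exact incrementLE_word hV hf n w
    · exact hV.mul_comp (T.isConcaveBranch_word n w) fun y hy =>
        hM _ ((T.isConcaveBranch_word n w).mapsTo hy)
  have hbound : ∀ S : Finset (Word n), ∑ w ∈ S, T.wordWeight n w 0 * (Δ w + R w) ≤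
      1 / 2 * (V 1 - V 0) + (C₁ + 1 / 6) * N := by
    intro S
    have h1 : ∀ w ∈ S, T.wordWeight n w 0 * (Δ w + R w) ≤ 1 / 3 * Δ w +
        ((if w ∈ F then T.wordWeight n w 0 * c w * N else 0) +
          if w ∉ F then T.wordWeight n w 0 * (V 1 - V 0 + N) else 0) := by
      intro w _
      have h := mul_le_mul_of_nonneg_right (hn w) (hΔ0 w)
      by_cases hw : w ∈ F
      · simp only [hR, hw, if_true, not_true_eq_false, if_false]
        linarith
      · simp only [hR, hw, if_true, not_false_eq_true, if_false]
        linarith [hΔ0 w]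
    refine (Finset.sum_le_sum h1).trans ?_
    rw [Finset.sum_add_distrib, Finset.sum_add_distrib, ← Finset.mul_sum, ← Finset.sum_filter,
      ← Finset.sum_filter, ← Finset.sum_mul, ← Finset.sum_mul]
    have h2 := T.sum_word_sub_le n hV.monotoneOn S
    have h3 : ∑ w ∈ S with w ∈ F, T.wordWeight n w 0 * c w ≤ C₁ :=
      Finset.sum_le_sum_of_subset_of_nonneg (fun w hw => (Finset.mem_filter.1 hw).2)
        fun w _ _ => mul_nonneg (T.wordWeight_zero_nonneg n w) (hc0 w)
    have h4 : ∑ w ∈ S with w ∉ F, T.wordWeight n w 0 ≤ 1 / 6 :=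
      (Real.le_norm_self _).trans (hF _ (Finset.disjoint_left.2 fun w hw =>
        (Finset.mem_filter.1 hw).2)).le
    have h5 := mul_le_mul_of_nonneg_right h3 hN0
    have h6 := mul_le_mul_of_nonneg_right h4 (add_nonneg hW0 hN0)
    linarith
  have hpart : ∀ S : Finset (Word n),
      eVariationOn (fun y => ∑ w ∈ S, f (T.wordInv n w y) * T.wordWeight n w y) (Icc 0 1) ≤
        ENNReal.ofReal (1 / 2 * (V 1 - V 0) + (C₁ + 1 / 6) * N) := by
    intro S
    refine (IncrementLE.sum S hinc).eVariationOn_le.trans (ENNReal.ofReal_le_ofReal ?_)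
    refine le_trans ?_ (hbound S)
    rw [← Finset.sum_sub_distrib]
    refine Finset.sum_le_sum fun w _ => ?_
    have := mul_nonneg (hR0 w) ((T.isConcaveBranch_word n w).nonneg 1 one_mem_Icc)
    simp only [hΔ]
    linarith
  by_contra! hlt
  obtain ⟨S, hS⟩ := (eVariationOn.lowerSemicontinuous_aux (p := atTop)
    (F := fun (S : Finset (Word n)) y => ∑ w ∈ S, f (T.wordInv n w y) * T.wordWeight n w y)
    (fun y hy => by
      rw [iterate_transfer_eq_tsum n hM hy]
      exact (summable_mul_wordWeight n hM hy).hasSum) hlt).exists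
  exact (hpart S).not_gt hS

theorem integral_abs_iterate_transfer_le {M : ℝ} (n : ℕ) (hf : IntegrableOn f (Icc 0 1))
    (hM : ∀ x ∈ Icc (0:ℝ) 1, |f x| ≤ M) :
    ∫ x in Icc (0:ℝ) 1, |T.transfer^[n] f x| ≤ ∫ x in Icc (0:ℝ) 1, |f x| := by
  have hM' : ∀ x ∈ Icc (0:ℝ) 1, |(fun x => |f x|) x| ≤ M := by simpa using hM
  have h := setIntegral_iterate_transfer (T := T) n hf.abs hM' measurableSet_Icc Subset.rfl
  rw [inter_eq_right.2 (T.maps_to.iterate n).subset_preimage] at h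
  rw [← h]
  refine setIntegral_mono_on (integrableOn_iterate_transfer n hf hM).abs
    (integrableOn_iterate_transfer n hf.abs hM') measurableSet_Icc fun y hy => ?_
  rw [iterate_transfer_eq_tsum n hM hy, iterate_transfer_eq_tsum n hM' hy]
  refine tsum_of_norm_bounded (f := fun w : Word n => f (T.wordInv n w y) * T.wordWeight n w y)
    (summable_mul_wordWeight n hM' hy).hasSum fun w => ?_
  rw [norm_mul, Real.norm_eq_abs, Real.norm_eq_abs,
    abs_of_nonneg ((T.isConcaveBranch_word n w).nonneg y hy)]

end PCT

/-- Proposition 2.2.5. Let `τ ∈ 𝒯`. Then there exist `n ∈ ℕ` and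
`C > 0` such that for every `f ∈ BV_I` and every version `Pf` of `P_τⁿ f` (characterized
by `∫_A Pf dm = ∫_{(τⁿ)⁻¹ A} f dm`), `Pf` agrees a.e. with a function `Pf'` satisfying
`‖Pf'‖_BV ≤ (1/2)·‖f‖_BV + C·‖f‖₁`, where `‖f‖_BV = ‖f‖₁ + var_I f`. -/
theorem lasotaYorke_BV_inequality (T : PCT) :
    ∃ (n : ℕ) (C : ℝ), 0 < C ∧
      ∀ f : ℝ → ℝ, MeasureTheory.IntegrableOn f (Set.Icc (0:ℝ) 1) →
        BoundedVariationOn f (Set.Icc (0:ℝ) 1) →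
      ∀ Pf : ℝ → ℝ, MeasureTheory.IntegrableOn Pf (Set.Icc (0:ℝ) 1) →
        (∀ A : Set ℝ, MeasurableSet A → A ⊆ Set.Icc (0:ℝ) 1 →
          ∫ x in A, Pf x = ∫ x in T.τ^[n] ⁻¹' A ∩ Set.Icc (0:ℝ) 1, f x) →
        ∃ Pf' : ℝ → ℝ, Pf' =ᵐ[volume.restrict (Set.Icc (0:ℝ) 1)] Pf ∧
          ENNReal.ofReal (∫ x in Set.Icc (0:ℝ) 1, |Pf' x|) +
              eVariationOn Pf' (Set.Icc (0:ℝ) 1) ≤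
            (1/2) * (ENNReal.ofReal (∫ x in Set.Icc (0:ℝ) 1, |f x|) +
              eVariationOn f (Set.Icc (0:ℝ) 1)) +
            ENNReal.ofReal (C * ∫ x in Set.Icc (0:ℝ) 1, |f x|) := by
  obtain ⟨n, C, hC, hvar⟩ := T.exists_eVariationOn_iterate_transfer_le
  refine ⟨n, C + 1, by positivity, fun f hf hbv Pf hPf hA => ?_⟩
  have hV := hbv.incrementLE
  have hM := PCT.abs_le_of_incrementLE hV hf
  refine ⟨T.transfer^[n] f, ?_, ?_⟩
  · refine Integrable.ae_eq_of_forall_setIntegral_eq _ _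
      (PCT.integrableOn_iterate_transfer n hf hM) hPf fun A hA' _ => ?_
    rw [Measure.restrict_restrict hA', hA _ (hA'.inter measurableSet_Icc) inter_subset_right]
    exact PCT.setIntegral_iterate_transfer n hf hM (hA'.inter measurableSet_Icc)
      inter_subset_right
  · have hv := hvar f _ hV hf
    have hl := PCT.integral_abs_iterate_transfer_le (T := T) n hf hM
    rw [variationOnFromTo.self, sub_zero, variationOnFromTo.eq_of_le _ _ zero_le_one,
      inter_self] at hv
    set N : ℝ := ∫ x in Icc (0:ℝ) 1, |f x|
    have hN : 0 ≤ N := integral_nonneg fun x => abs_nonneg _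
    have hW : 0 ≤ (eVariationOn f (Icc (0:ℝ) 1)).toReal := ENNReal.toReal_nonneg
    refine (add_le_add (ENNReal.ofReal_le_ofReal hl) hv).trans ?_
    have h2 : (1 / 2 : ENNReal) = ENNReal.ofReal (1 / 2) := by
      rw [ENNReal.ofReal_div_of_pos two_pos]; simp
    rw [← ENNReal.ofReal_toReal hbv, h2, ← ENNReal.ofReal_add hN hW,
      ← ENNReal.ofReal_mul (by norm_num), ← ENNReal.ofReal_add hN (by positivity),
      ← ENNReal.ofReal_add (by positivity) (by positivity)]
    refine ENNReal.ofReal_le_ofReal ?_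
    rw [ENNReal.toReal_ofReal hW]
    linarith
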